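/- For every R > 0 the following equivalence holds: there exists ξ ∈ (0, β) with F(1) + (R² − 1)·F(ξ) = 0 if and only if F(1) + (R² − 1)·F(a) ≤ 0. -/

import Mathlib

open Set Filter Topology

/-- The primitive `F(s) = ∫₀^s f(r) dr`. -/
noncomputable def F (f : ℝ → ℝ) (s : ℝ) : ℝ := ∫ r in (0:ℝ)..s, f r

/-- Bistable nonlinearity with balanced-positive integral. -/
def Bistable (f : ℝ → ℝ) (a : ℝ) : Prop :=
  ContDiff ℝ 1 f ∧ 0 < a ∧ a < 1 ∧
  f 0 = 0 ∧ f a = 0 ∧ f 1 = 0 ∧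
  (∀ s, 0 < s → s < a → f s < 0) ∧
  (∀ s, a < s → s < 1 → 0 < f s) ∧
  deriv f 0 < 0 ∧ 0 < deriv f a ∧ deriv f 1 < 0 ∧
  0 < ∫ s in (0:ℝ)..(1:ℝ), f s


theorem hasDerivAt_F {f : ℝ → ℝ} (hf : Continuous f) (s : ℝ) : HasDerivAt (F f) (f s) s :=
  intervalIntegral.integral_hasDerivAt_right (hf.intervalIntegrable _ _)
    hf.stronglyMeasurable.stronglyMeasurableAtFilter hf.continuousAt

theorem continuous_F {f : ℝ → ℝ} (hf : Continuous f) : Continuous (F f) :=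
  continuous_iff_continuousAt.2 fun s => (hasDerivAt_F hf s).continuousAt

theorem monotoneOn_F {f : ℝ → ℝ} (hf : Continuous f) {b c : ℝ}
    (h : ∀ s, b < s → s < c → 0 < f s) : MonotoneOn (F f) (Icc b c) := by
  refine monotoneOn_of_hasDerivWithinAt_nonneg (convex_Icc b c) (continuous_F hf).continuousOn
    (fun s _ => (hasDerivAt_F hf s).hasDerivWithinAt) fun s hs => ?_
  rw [interior_Icc] at hs
  exact (h s hs.1 hs.2).le

theorem antitoneOn_F {f : ℝ → ℝ} (hf : Continuous f) {b c : ℝ}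
    (h : ∀ s, b < s → s < c → f s < 0) : AntitoneOn (F f) (Icc b c) := by
  refine antitoneOn_of_hasDerivWithinAt_nonpos (convex_Icc b c) (continuous_F hf).continuousOn
    (fun s _ => (hasDerivAt_F hf s).hasDerivWithinAt) fun s hs => ?_
  rw [interior_Icc] at hs
  exact (h s hs.1 hs.2).le

/-- Solvability of the Kirchhoff matching condition `F(1) + (R²−1)F(ξ) = 0`
for some `ξ ∈ (0,β)` is equivalent to `F(1) + (R²−1)F(a) ≤ 0`. -/
theorem kirchhoff_matching_solvable_iff (f : ℝ → ℝ) (a β : ℝ) (hf : Bistable f a)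
    (hβ : a < β ∧ β < 1 ∧ F f β = 0) (R : ℝ) (hR : 0 < R) :
    (∃ ξ : ℝ, 0 < ξ ∧ ξ < β ∧ F f 1 + (R^2 - 1) * F f ξ = 0) ↔
      F f 1 + (R^2 - 1) * F f a ≤ 0 := by
  obtain ⟨hC, ha, ha', -, -, -, hneg, hpos, -, -, -, hint⟩ := hf
  obtain ⟨haβ, hβ1, hFβ⟩ := hβ
  have hc := hC.continuous
  have hF0 : F f 0 = 0 := intervalIntegral.integral_same
  have hF1 : 0 < F f 1 := hint
  have hanti := antitoneOn_F hc hneg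
  have hmono := monotoneOn_F hc hpos
  constructor
  · rintro ⟨ξ, hξ, hξβ, h⟩
    obtain ⟨hmin, hnonpos⟩ : F f a ≤ F f ξ ∧ F f ξ ≤ 0 := by
      rcases le_total ξ a with hξa | hξa
      · exact ⟨hanti ⟨hξ.le, hξa⟩ ⟨ha.le, le_rfl⟩ hξa,
          hF0 ▸ hanti ⟨le_rfl, ha.le⟩ ⟨hξ.le, hξa⟩ hξ.le⟩
      · exact ⟨hmono ⟨le_rfl, ha'.le⟩ ⟨hξa, (hξβ.trans hβ1).le⟩ hξa,
          hFβ ▸ hmono ⟨hξa, (hξβ.trans hβ1).le⟩ ⟨haβ.le, hβ1.le⟩ hξβ.le⟩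
    rcases le_total 0 (R ^ 2 - 1) with hR1 | hR1
    · linarith [mul_le_mul_of_nonneg_left hmin hR1]
    · linarith [mul_nonneg_of_nonpos_of_nonpos hR1 hnonpos]
  · intro h
    have hg : ContinuousOn (fun s => F f 1 + (R ^ 2 - 1) * F f s) (Icc 0 a) :=
      (continuous_const.add (continuous_const.mul (continuous_F hc))).continuousOn
    obtain ⟨ξ, ⟨hξ0, hξa⟩, hξ⟩ :=
      intermediate_value_Icc' ha.le hg ⟨h, by simpa [hF0] using hF1.le⟩
    refine ⟨ξ, hξ0.lt_of_ne ?_, hξa.trans_lt haβ, hξ⟩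
    rintro rfl
    simp [hF0, hF1.ne'] at hξ
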